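/- Let Λ be an infinite set (countably or uncountably infinite) and let Γ be a subshift of Λ^ω which is a subshift of finite type. Then Γ is internally chain transitive. -/

import Mathlib

open Set Filter Topology

/-- The shift map `σ` on `ℕ → Λ`, defined by `σ(x)(n) = x(n+1)`. -/
def shift {Λ : Type*} (x : ℕ → Λ) : ℕ → Λ := fun n => x (n + 1)

/-- The Baire metric `d(x,y) = inf {2^{-n} : x_i = y_i for all i < n}`. -/
noncomputable def bDist {Λ : Type*} (x y : ℕ → Λ) : ℝ :=
  sInf {r : ℝ | ∃ n : ℕ, r = (2 : ℝ)⁻¹ ^ n ∧ ∀ i < n, x i = y i}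

/-- `Γ` is a subshift: a closed, shift-invariant subset of `ℕ → Λ`. -/
def IsSubshift {Λ : Type*} [TopologicalSpace Λ] (Γ : Set (ℕ → Λ)) : Prop :=
  IsClosed Γ ∧ shift '' Γ = Γ

/-- The finite word `w` is allowed in `Γ`: it occurs as a consecutive block in some point of `Γ`. -/
def Allowed {Λ : Type*} (Γ : Set (ℕ → Λ)) (w : List Λ) : Prop :=
  ∃ x ∈ Γ, ∃ i : ℕ, ∀ (j : ℕ) (h : j < w.length), x (i + j) = w.get ⟨j, h⟩

/-- `F` is a basis for the forbidden words of `Γ`: each member of `F` is forbidden, and every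
forbidden word contains a member of `F` as a consecutive (infix) subword. -/
def IsForbiddenBasis {Λ : Type*} (Γ : Set (ℕ → Λ)) (F : Set (List Λ)) : Prop :=
  (∀ w ∈ F, ¬ Allowed Γ w) ∧ ∀ w : List Λ, ¬ Allowed Γ w → ∃ v ∈ F, v <:+: w

/-- `Γ` is a subshift of finite type: it has a finite basis for its forbidden words. -/
def IsSFT {Λ : Type*} (Γ : Set (ℕ → Λ)) : Prop :=
  ∃ F : Set (List Λ), F.Finite ∧ IsForbiddenBasis Γ F

/-- `Γ` is a subshift of bounded type: it has a basis for its forbidden words whose members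
have uniformly bounded length. -/
def IsSBT {Λ : Type*} (Γ : Set (ℕ → Λ)) : Prop :=
  ∃ F : Set (List Λ), (∃ N : ℕ, ∀ w ∈ F, w.length ≤ N) ∧ IsForbiddenBasis Γ F

/-- `A` is internally chain transitive for the shift (w.r.t. the Baire metric): for all
`a, b ∈ A` and `δ > 0` there is a `δ`-chain from `a` to `b` consisting of elements of `A`. -/
def IsICT {Λ : Type*} (A : Set (ℕ → Λ)) : Prop :=
  ∀ a ∈ A, ∀ b ∈ A, ∀ δ : ℝ, 0 < δ → ∃ n : ℕ, 1 ≤ n ∧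
    ∃ c : ℕ → (ℕ → Λ), c 0 = a ∧ c n = b ∧ (∀ i ≤ n, c i ∈ A) ∧
      ∀ i < n, bDist (shift (c i)) (c (i + 1)) < δ

theorem shift_iterate_apply {Λ : Type*} (x : ℕ → Λ) (k j : ℕ) :
    shift^[k] x j = x (k + j) := by
  induction k generalizing x with
  | zero => simp
  | succ k ih =>
    rw [Function.iterate_succ_apply, ih]
    exact congrArg x (by omega)

theorem IsSubshift.iterate_mem {Λ : Type*} [TopologicalSpace Λ] {Γ : Set (ℕ → Λ)}
    (hΓ : IsSubshift Γ) {x : ℕ → Λ} (hx : x ∈ Γ) (k : ℕ) : shift^[k] x ∈ Γ := by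
  induction k with
  | zero => exact hx
  | succ k ih =>
    rw [Function.iterate_succ_apply', ← hΓ.2]
    exact mem_image_of_mem _ ih

theorem bDist_le {Λ : Type*} {x y : ℕ → Λ} {n : ℕ} (h : ∀ i < n, x i = y i) :
    bDist x y ≤ (2 : ℝ)⁻¹ ^ n := by
  refine csInf_le ⟨0, ?_⟩ ⟨n, rfl, h⟩
  rintro r ⟨m, rfl, -⟩
  positivity

theorem bDist_self_lt {Λ : Type*} (x : ℕ → Λ) {δ : ℝ} (hδ : 0 < δ) : bDist x x < δ := by
  obtain ⟨n, hn⟩ := exists_pow_lt_of_lt_one hδ (show (2 : ℝ)⁻¹ < 1 by norm_num)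
  exact (bDist_le fun _ _ => rfl).trans_lt hn

/-- A closed set of sequences contains every sequence whose prefixes extend to its members. -/
theorem mem_of_forall_prefix {Λ : Type*} [TopologicalSpace Λ] {Γ : Set (ℕ → Λ)}
    (hΓ : IsClosed Γ) {p : ℕ → Λ} (h : ∀ m : ℕ, ∃ x ∈ Γ, ∀ j < m, x j = p j) : p ∈ Γ := by
  choose x hx hp using h
  refine hΓ.mem_of_tendsto (f := x) (b := atTop) (tendsto_pi_nhds.2 fun j => ?_)
    (Eventually.of_forall hx)
  refine tendsto_const_nhds.congr' ?_
  filter_upwards [eventually_gt_atTop j] with m hm using (hp m j hm).symm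

/-- A sequence none of whose blocks lies in a basis of the forbidden words belongs to the
subshift. -/
theorem IsSubshift.mem_of_forall_block {Λ : Type*} [TopologicalSpace Λ] {Γ : Set (ℕ → Λ)}
    (hΓ : IsSubshift Γ) {F : Set (List Λ)} (hF : IsForbiddenBasis Γ F) {p : ℕ → Λ}
    (h : ∀ v ∈ F, ∀ k : ℕ, ¬ ∀ (j : ℕ) (hj : j < v.length), p (k + j) = v[j]) : p ∈ Γ := by
  refine mem_of_forall_prefix hΓ.1 fun m => ?_
  have hm : Allowed Γ ((List.range m).map p) := by
    by_contra hw
    obtain ⟨v, hv, s, t, hst⟩ := hF.2 _ hw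
    refine h v hv s.length fun j hj => ?_
    have hlen : s.length + j < m := by
      have := congrArg List.length hst
      simp only [List.length_append, List.length_map, List.length_range] at this
      omega
    have h₁ : ((List.range m).map p)[s.length + j]? = some (p (s.length + j)) := by
      simp [hlen]
    rw [← hst, List.append_assoc, List.getElem?_append_right (by omega),
      Nat.add_sub_cancel_left, List.getElem?_append_left hj, List.getElem?_eq_getElem hj] at h₁
    exact (Option.some.inj h₁).symm
  obtain ⟨x, hx, i, hi⟩ := hm
  refine ⟨shift^[i] x, hΓ.iterate_mem hx i, fun j hj => ?_⟩
  rw [shift_iterate_apply, hi j (by simpa using hj)]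
  simp

/-- The sequence `a 0, …, a (n - 1), s, b 0, b 1, …`. -/
def splice {Λ : Type*} (n : ℕ) (s : Λ) (a b : ℕ → Λ) : ℕ → Λ :=
  fun i => if i < n then a i else if i = n then s else b (i - (n + 1))

theorem splice_of_lt {Λ : Type*} {n i : ℕ} (s : Λ) (a b : ℕ → Λ) (h : i < n) :
    splice n s a b i = a i := if_pos h

theorem splice_self {Λ : Type*} (n : ℕ) (s : Λ) (a b : ℕ → Λ) : splice n s a b n = s := by
  simp [splice]

theorem splice_of_gt {Λ : Type*} {n i : ℕ} (s : Λ) (a b : ℕ → Λ) (h : n < i) :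
    splice n s a b i = b (i - (n + 1)) := by
  simp [splice, h.not_gt, h.ne']

theorem shift_iterate_splice {Λ : Type*} (n : ℕ) (s : Λ) (a b : ℕ → Λ) :
    shift^[n + 1] (splice n s a b) = b := by
  funext j
  rw [shift_iterate_apply, splice_of_gt s a b (by omega), Nat.add_sub_cancel_left]

/-- Members of a subshift may be spliced along a letter that does not occur in a basis of the
forbidden words. -/
theorem IsSubshift.splice_mem {Λ : Type*} [TopologicalSpace Λ] {Γ : Set (ℕ → Λ)}
    (hΓ : IsSubshift Γ) {F : Set (List Λ)} (hF : IsForbiddenBasis Γ F) {s : Λ}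
    (hs : ∀ v ∈ F, s ∉ v) {a b : ℕ → Λ} (ha : a ∈ Γ) (hb : b ∈ Γ) (n : ℕ) :
    splice n s a b ∈ Γ := by
  refine hΓ.mem_of_forall_block hF fun v hv k hk => ?_
  rcases lt_or_ge n k with hnk | hkn
  · refine hF.1 v hv ⟨b, hb, k - (n + 1), fun j hj => ?_⟩
    rw [List.get_eq_getElem, ← hk j hj, splice_of_gt s a b (by omega)]
    exact congrArg b (by omega)
  · rcases lt_or_ge n (k + v.length) with hnl | hln
    · have hj : n - k < v.length := by omega
      have hjs := hk (n - k) hj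
      rw [Nat.add_sub_cancel' hkn, splice_self] at hjs
      exact hs v hv (hjs ▸ List.getElem_mem hj)
    · refine hF.1 v hv ⟨a, ha, k, fun j hj => ?_⟩
      rw [List.get_eq_getElem, ← hk j hj, splice_of_lt s a b (by omega)]

/-- Over an infinite alphabet some letter occurs in no word of a given finite set. -/
theorem exists_letter_notMem {Λ : Type*} [Infinite Λ] {F : Set (List Λ)} (hF : F.Finite) :
    ∃ s : Λ, ∀ v ∈ F, s ∉ v := by
  obtain ⟨s, hs⟩ := (hF.biUnion fun v _ => v.finite_toSet).exists_notMem
  exact ⟨s, fun v hv hsv => hs (mem_biUnion hv hsv)⟩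

/-- A subshift of finite type over an infinite alphabet is internally chain transitive. -/
theorem sft_infinite_ict {Λ : Type*} [TopologicalSpace Λ] [DiscreteTopology Λ] [Infinite Λ]
    (Γ : Set (ℕ → Λ)) (hΓ : IsSubshift Γ) (hSFT : IsSFT Γ) :
    IsICT Γ := by
  intro a ha b hb δ hδ
  obtain ⟨F, hfin, hF⟩ := hSFT
  obtain ⟨s, hs⟩ := exists_letter_notMem hfin
  obtain ⟨n, hn⟩ := exists_pow_lt_of_lt_one hδ (show (2 : ℝ)⁻¹ < 1 by norm_num)
  have hp := hΓ.splice_mem hF hs (hΓ.iterate_mem ha 1) hb n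
  set p := splice n s (shift^[1] a) b
  refine ⟨n + 2, by omega, fun i => Nat.casesOn i a fun k => shift^[k] p, rfl,
    shift_iterate_splice n s _ b, ?_, ?_⟩
  · rintro (_ | k) -
    · exact ha
    · exact hΓ.iterate_mem hp k
  · rintro (_ | k) -
    · exact (bDist_le fun i hi => (splice_of_lt s _ b hi).symm).trans_lt hn
    · change bDist (shift (shift^[k] p)) (shift^[k + 1] p) < δ
      rw [Function.iterate_succ_apply']
      exact bDist_self_lt _ hδ
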